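/- (Proposition 3.1(c)) Let h : ℝ → ℝ be a Schwartz function and let g = (1-Π)h = h - σ√M - u v√M, where σ = ∫_ℝ h √M dv and u = ∫_ℝ h v √M dv (so that ∫_ℝ g √M dv = 0 and ∫_ℝ g v √M dv = 0). Then -∫_ℝ g (L g) dv ≥ ∫_ℝ g(v)² dv. -/

import Mathlib

open MeasureTheory Real

/-- The one-dimensional global Maxwellian. -/
noncomputable def Maxwellian (v : ℝ) : ℝ := (2 * Real.pi) ^ (-(1:ℝ)/2) * Real.exp (-v^2 / 2)

/-- The linearized Fokker–Planck operator
`(L f)(v) = M(v)^(-1/2) d/dv ( M(v) d/dv ( f(v) M(v)^(-1/2) ) )`. -/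
noncomputable def FPL (f : ℝ → ℝ) : ℝ → ℝ := fun v =>
  (Maxwellian v) ^ (-(1:ℝ)/2) *
    deriv (fun w => Maxwellian w * deriv (fun y => f y * (Maxwellian y) ^ (-(1:ℝ)/2)) w) v

open Filter Topology Set

/-- A function bounded by a multiple of `1 / |x|` vanishes at infinity. -/
theorem tendsto_zero_of_abs_mul_bounded {f : ℝ → ℝ} {C : ℝ} (hC : ∀ x, |x| * |f x| ≤ C) :
    Tendsto f (cocompact ℝ) (𝓝 0) := by
  have hlim : Tendsto (fun x : ℝ => C * |x|⁻¹) (cocompact ℝ) (𝓝 0) := by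
    have h := (tendsto_inv_atTop_zero.comp (tendsto_norm_cocompact_atTop (E := ℝ))).const_mul C
    simpa [Function.comp_def] using h
  refine squeeze_zero_norm' ?_ hlim
  have hne : ∀ᶠ x : ℝ in cocompact ℝ, 0 < ‖x‖ :=
    tendsto_norm_cocompact_atTop.eventually (eventually_gt_atTop 0)
  filter_upwards [hne] with x hx
  rw [← div_eq_mul_inv]
  exact (le_div_iff₀' hx).2 (by simpa using hC x)

/-- Continuous functions that decay faster than every power. -/
structure RapidDecay (f : ℝ → ℝ) : Prop where
  continuous : Continuous f
  decay : ∀ k : ℕ, ∃ C, ∀ x, |x| ^ k * |f x| ≤ C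

namespace RapidDecay

variable {f g : ℝ → ℝ}

theorem add (hf : RapidDecay f) (hg : RapidDecay g) : RapidDecay (fun x => f x + g x) := by
  refine ⟨hf.continuous.add hg.continuous, fun k => ?_⟩
  obtain ⟨C, hC⟩ := hf.decay k
  obtain ⟨D, hD⟩ := hg.decay k
  refine ⟨C + D, fun x => ?_⟩
  calc |x| ^ k * |f x + g x| ≤ |x| ^ k * (|f x| + |g x|) := by
        gcongr; exact abs_add_le _ _
    _ ≤ C + D := by rw [mul_add]; exact add_le_add (hC x) (hD x)

theorem const_mul (c : ℝ) (hf : RapidDecay f) : RapidDecay (fun x => c * f x) := by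
  refine ⟨hf.continuous.const_mul c, fun k => ?_⟩
  obtain ⟨C, hC⟩ := hf.decay k
  refine ⟨|c| * C, fun x => ?_⟩
  calc |x| ^ k * |c * f x| = |c| * (|x| ^ k * |f x|) := by rw [abs_mul]; ring
    _ ≤ |c| * C := by gcongr; exact hC x

theorem sub (hf : RapidDecay f) (hg : RapidDecay g) : RapidDecay (fun x => f x - g x) := by
  simpa [sub_eq_add_neg] using hf.add (hg.const_mul (-1))

theorem id_mul (hf : RapidDecay f) : RapidDecay (fun x => x * f x) := by
  refine ⟨continuous_id.mul hf.continuous, fun k => ?_⟩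
  obtain ⟨C, hC⟩ := hf.decay (k + 1)
  refine ⟨C, fun x => ?_⟩
  simpa [abs_mul, pow_succ, mul_assoc] using hC x

theorem mul (hf : RapidDecay f) (hg : RapidDecay g) : RapidDecay (fun x => f x * g x) := by
  refine ⟨hf.continuous.mul hg.continuous, fun k => ?_⟩
  obtain ⟨C, hC⟩ := hf.decay k
  obtain ⟨D, hD⟩ := hg.decay 0
  refine ⟨C * D, fun x => ?_⟩
  have hD' : |g x| ≤ D := by simpa using hD x
  have hC0 : 0 ≤ C := le_trans (by positivity) (hC x)
  rw [abs_mul, ← mul_assoc]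
  exact mul_le_mul (hC x) hD' (abs_nonneg _) hC0

theorem integrable (hf : RapidDecay f) : Integrable f := by
  obtain ⟨C, hC⟩ := hf.decay 0
  obtain ⟨D, hD⟩ := hf.decay 2
  refine (integrable_inv_one_add_sq.const_mul (C + D)).mono'
    hf.continuous.aestronglyMeasurable (Eventually.of_forall fun x => ?_)
  have h0 := hC x
  have h2 := hD x
  rw [sq_abs] at h2
  rw [pow_zero, one_mul] at h0
  rw [Real.norm_eq_abs, ← div_eq_mul_inv, le_div_iff₀ (by positivity)]
  linarith

theorem tendsto_zero (hf : RapidDecay f) : Tendsto f (cocompact ℝ) (𝓝 0) := by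
  obtain ⟨C, hC⟩ := hf.decay 1
  exact tendsto_zero_of_abs_mul_bounded (by simpa using hC)

end RapidDecay

theorem SchwartzMap.rapidDecay (h : SchwartzMap ℝ ℝ) : RapidDecay h := by
  refine ⟨h.continuous, fun k => ?_⟩
  obtain ⟨C, -, hC⟩ := h.decay k 0
  exact ⟨C, fun x => by simpa using hC x⟩

theorem hasDerivAt_exp_neg_sq_div_four (v : ℝ) :
    HasDerivAt (fun x : ℝ => Real.exp (-x ^ 2 / 4)) (-(v / 2) * Real.exp (-v ^ 2 / 4)) v := by
  have h : HasDerivAt (fun x : ℝ => -x ^ 2 / 4) (-(v / 2)) v := by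
    refine (((hasDerivAt_pow 2 v).neg).div_const 4).congr_deriv ?_
    norm_num; ring
  exact h.exp.congr_deriv (by ring)

theorem hasDerivAt_exp_sq_div_four (v : ℝ) :
    HasDerivAt (fun x : ℝ => Real.exp (x ^ 2 / 4)) (v / 2 * Real.exp (v ^ 2 / 4)) v := by
  have h : HasDerivAt (fun x : ℝ => x ^ 2 / 4) (v / 2) v := by
    refine ((hasDerivAt_pow 2 v).div_const 4).congr_deriv ?_
    norm_num; ring
  exact h.exp.congr_deriv (by ring)

theorem exp_sq_mul_exp_neg_sq (v : ℝ) : Real.exp (v ^ 2 / 4) * Real.exp (-v ^ 2 / 4) = 1 := by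
  rw [← Real.exp_add]; ring_nf; exact Real.exp_zero

theorem rapidDecay_exp_neg_sq_div_four : RapidDecay (fun x : ℝ => Real.exp (-x ^ 2 / 4)) := by
  refine ⟨by fun_prop, fun k => ⟨Real.exp 1 * k.factorial, fun x => ?_⟩⟩
  have h1 : |x| ^ k ≤ k.factorial * Real.exp |x| := by
    have := Real.pow_div_factorial_le_exp |x| (abs_nonneg x) k
    rwa [div_le_iff₀' (by positivity)] at this
  have h2 : Real.exp |x| * Real.exp (-x ^ 2 / 4) ≤ Real.exp 1 := by
    rw [← Real.exp_add, Real.exp_le_exp, ← sq_abs x]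
    nlinarith [sq_nonneg (|x| - 2)]
  rw [abs_of_pos (Real.exp_pos _)]
  calc |x| ^ k * Real.exp (-x ^ 2 / 4)
      ≤ k.factorial * Real.exp |x| * Real.exp (-x ^ 2 / 4) := by gcongr
    _ = k.factorial * (Real.exp |x| * Real.exp (-x ^ 2 / 4)) := by ring
    _ ≤ k.factorial * Real.exp 1 := by gcongr
    _ = _ := by ring

/-- If `F` vanishes at infinity and `F' ≤ Q` with `Q` integrable, then `∫ Q ≥ 0`. -/
theorem integral_nonneg_of_hasDerivAt_le {F F' Q : ℝ → ℝ} (hF : ∀ x, HasDerivAt F (F' x) x)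
    (hle : ∀ x, F' x ≤ Q x) (hQ : Integrable Q) (hlim : Tendsto F (cocompact ℝ) (𝓝 0)) :
    0 ≤ ∫ x, Q x := by
  have hint := intervalIntegral_tendsto_integral hQ tendsto_neg_atTop_atBot tendsto_id
  have hbd : Tendsto (fun x => F x - F (-x)) atTop (𝓝 0) := by
    simpa using (hlim.mono_left atTop_le_cocompact).sub
      ((hlim.mono_left atBot_le_cocompact).comp tendsto_neg_atTop_atBot)
  refine le_of_tendsto_of_tendsto hbd hint ?_
  filter_upwards [eventually_ge_atTop 0] with x hx
  exact intervalIntegral.sub_le_integral_of_hasDeriv_right_of_le (by simpa using hx)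
    (fun y _ => (hF y).continuousAt.continuousWithinAt) (fun y _ => (hF y).hasDerivWithinAt)
    hQ.integrableOn (fun y _ => hle y)

theorem abs_mul_setIntegral_le {g : ℝ → ℝ} (hg : RapidDecay g) {v : ℝ} {S : Set ℝ}
    (hS : MeasurableSet S) (hv : ∀ s ∈ S, |v| ≤ |s|) :
    |v| * |∫ s in S, g s * Real.exp (-s ^ 2 / 4)| ≤
      Real.exp (-v ^ 2 / 4) * ∫ s, |s * g s| := by
  have hi := hg.id_mul.integrable.abs
  have hgE := (hg.mul rapidDecay_exp_neg_sq_div_four).integrable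
  calc |v| * |∫ s in S, g s * Real.exp (-s ^ 2 / 4)|
      ≤ |v| * ∫ s in S, |g s * Real.exp (-s ^ 2 / 4)| := by
        gcongr; exact abs_integral_le_integral_abs
    _ = ∫ s in S, |v| * |g s * Real.exp (-s ^ 2 / 4)| := (integral_const_mul _ _).symm
    _ ≤ ∫ s in S, Real.exp (-v ^ 2 / 4) * |s * g s| := by
        refine setIntegral_mono_on (hgE.abs.const_mul _).integrableOn
          (hi.const_mul _).integrableOn hS fun s hs => ?_
        have h1 : Real.exp (-s ^ 2 / 4) ≤ Real.exp (-v ^ 2 / 4) := by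
          rw [Real.exp_le_exp]
          have := sq_le_sq.2 (hv s hs)
          linarith
        rw [abs_mul, abs_mul, abs_of_pos (Real.exp_pos _)]
        calc |v| * (|g s| * Real.exp (-s ^ 2 / 4))
            ≤ |s| * (|g s| * Real.exp (-v ^ 2 / 4)) := by
              exact mul_le_mul (hv s hs) (by gcongr) (by positivity) (abs_nonneg _)
          _ = _ := by ring
    _ ≤ ∫ s, Real.exp (-v ^ 2 / 4) * |s * g s| :=
        setIntegral_le_integral (hi.const_mul _) (Eventually.of_forall fun s => by positivity)
    _ = _ := integral_const_mul _ _

/-- A function orthogonal to the Gaussian `exp (-v² / 4)` is in the range of `v / 2 - d/dv`,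
with a preimage that is `O(1 / |v|)`. -/
theorem exists_hasDerivAt_of_integral_eq_zero {g : ℝ → ℝ} (hg : RapidDecay g)
    (h0 : ∫ v, g v * Real.exp (-v ^ 2 / 4) = 0) :
    ∃ w : ℝ → ℝ, (∀ v, HasDerivAt w (v / 2 * w v - g v) v) ∧ ∃ B, ∀ v, |v| * |w v| ≤ B := by
  set φ : ℝ → ℝ := fun s => g s * Real.exp (-s ^ 2 / 4) with hφ
  have hR : RapidDecay φ := hg.mul rapidDecay_exp_neg_sq_div_four
  set G : ℝ → ℝ := fun v => ∫ s in Iic v, φ s with hG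
  have hGd : ∀ v, HasDerivAt G (φ v) v := fun v => by
    have hEq : G = fun v => (∫ s in (0 : ℝ)..v, φ s) + G 0 := by
      funext x
      rw [← intervalIntegral.integral_Iic_sub_Iic hR.integrable.integrableOn
        hR.integrable.integrableOn]
      simp [hG]
    rw [hEq]
    exact (hR.continuous.integral_hasStrictDerivAt 0 v).hasDerivAt.add_const _
  refine ⟨fun v => -(Real.exp (v ^ 2 / 4) * G v), fun v => ?_, ∫ s, |s * g s|, fun v => ?_⟩
  · refine ((hasDerivAt_exp_sq_div_four v).mul (hGd v)).neg.congr_deriv ?_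
    simp only [hφ]
    linear_combination (-g v) * exp_sq_mul_exp_neg_sq v
  · have key : |v| * |G v| ≤ Real.exp (-v ^ 2 / 4) * ∫ s, |s * g s| := by
      rcases le_total 0 v with hv | hv
      · have hsum : G v + ∫ s in Ioi v, φ s = 0 := by
          rw [← h0]
          exact intervalIntegral.integral_Iic_add_Ioi hR.integrable.integrableOn
            hR.integrable.integrableOn
        rw [eq_neg_of_add_eq_zero_left hsum, abs_neg]
        refine abs_mul_setIntegral_le hg measurableSet_Ioi fun s hs => ?_
        exact abs_le_abs_of_nonneg hv (le_of_lt hs)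
      · refine abs_mul_setIntegral_le hg measurableSet_Iic fun s hs => ?_
        exact abs_le_abs_of_nonpos hv hs
    rw [abs_neg, abs_mul, abs_of_pos (Real.exp_pos _)]
    calc |v| * (Real.exp (v ^ 2 / 4) * |G v|) = Real.exp (v ^ 2 / 4) * (|v| * |G v|) := by ring
      _ ≤ Real.exp (v ^ 2 / 4) * (Real.exp (-v ^ 2 / 4) * ∫ s, |s * g s|) := by gcongr
      _ = _ := by rw [← mul_assoc, exp_sq_mul_exp_neg_sq, one_mul]

/-- Spectral gap of the harmonic oscillator `-d²/dv² + v²/4 - 1/2` on the orthogonal complement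
of its ground state. -/
theorem integral_sq_le_of_integral_eq_zero {g g' g'' : ℝ → ℝ} (hg : RapidDecay g)
    (hg' : RapidDecay g') (hg'' : RapidDecay g'') (hd : ∀ v, HasDerivAt g (g' v) v)
    (hd' : ∀ v, HasDerivAt g' (g'' v) v) (h0 : ∫ v, g v * Real.exp (-v ^ 2 / 4) = 0) :
    ∫ v, g v ^ 2 ≤ -∫ v, g v * (g'' v + (1 / 2 - v ^ 2 / 4) * g v) := by
  obtain ⟨w, hw, B, hB⟩ := exists_hasDerivAt_of_integral_eq_zero hg h0
  have hw0 : Tendsto w (cocompact ℝ) (𝓝 0) := tendsto_zero_of_abs_mul_bounded hB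
  have hvw : Tendsto (fun v => v * w v ^ 2) (cocompact ℝ) (𝓝 0) := by
    have hlim : Tendsto (fun v => B * |w v|) (cocompact ℝ) (𝓝 0) := by
      simpa using hw0.abs.const_mul B
    refine squeeze_zero_norm (fun v => ?_) hlim
    rw [Real.norm_eq_abs, sq, ← mul_assoc, abs_mul, abs_mul]
    exact mul_le_mul_of_nonneg_right (hB v) (abs_nonneg _)
  have hsq : Integrable (fun v => g v ^ 2) := by
    simpa [sq] using (hg.mul hg).integrable
  have hL : Integrable (fun v => g v * (g'' v + (1 / 2 - v ^ 2 / 4) * g v)) := by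
    have := (hg.mul ((hg''.add (hg.const_mul (1 / 2))).sub
      (hg.id_mul.id_mul.const_mul (1 / 4)))).integrable
    refine this.congr (Eventually.of_forall fun v => ?_)
    ring
  have hF : ∀ v, HasDerivAt
      (fun v => -(g v * (g' v + v / 2 * g v)) - v * w v ^ 2 + 2 * (g v * w v))
      (-(g' v * (g' v + v / 2 * g v) + g v * (g'' v + (1 / 2 * g v + v / 2 * g' v)))
        - (w v ^ 2 + v * (2 * w v * (v / 2 * w v - g v)))
        + 2 * (g' v * w v + g v * (v / 2 * w v - g v))) v := fun v => by
    have hA := (hd' v).add (((hasDerivAt_id v).div_const 2).mul (hd v))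
    have h1 := ((hd v).mul hA).neg
    have h2 := (hasDerivAt_id v).mul ((hw v).pow 2)
    have h3 := ((hd v).mul (hw v)).const_mul 2
    refine ((h1.sub h2).add h3).congr_deriv ?_
    simp
  have hlim : Tendsto (fun v => -(g v * (g' v + v / 2 * g v)) - v * w v ^ 2 + 2 * (g v * w v))
      (cocompact ℝ) (𝓝 0) := by
    have h1 : Tendsto (fun v => g' v + v / 2 * g v) (cocompact ℝ) (𝓝 0) := by
      refine (hg'.add (hg.id_mul.const_mul (1 / 2))).tendsto_zero.congr fun v => ?_
      ring
    simpa using (((hg.tendsto_zero.mul h1).neg).sub hvw).add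
      ((hg.tendsto_zero.mul hw0).const_mul 2)
  have hpos := integral_nonneg_of_hasDerivAt_le
    (Q := fun v => -(g v * (g'' v + (1 / 2 - v ^ 2 / 4) * g v)) - g v ^ 2) hF
    (fun v => by
      nlinarith [sq_nonneg (g' v + v / 2 * g v - w v), sq_nonneg (v * w v - g v)])
    (hL.neg.sub hsq) hlim
  rw [integral_sub (by simpa using hL.neg) hsq, integral_neg] at hpos
  linarith

theorem sqrt_maxwellian (v : ℝ) :
    √(Maxwellian v) = √((2 * π) ^ (-(1 : ℝ) / 2)) * Real.exp (-v ^ 2 / 4) := by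
  rw [Maxwellian, Real.sqrt_mul (by positivity), ← Real.exp_half]
  ring_nf

theorem maxwellian_pos (v : ℝ) : 0 < Maxwellian v := by
  unfold Maxwellian; positivity

theorem FPL_eq {f f' f'' : ℝ → ℝ} (hd : ∀ v, HasDerivAt f (f' v) v)
    (hd' : ∀ v, HasDerivAt f' (f'' v) v) (v : ℝ) :
    FPL f v = f'' v + (1 / 2 - v ^ 2 / 4) * f v := by
  set c : ℝ := √((2 * π) ^ (-(1 : ℝ) / 2)) with hc
  have hcpos : 0 < c := by positivity
  have hM : ∀ v, Maxwellian v = (c * Real.exp (-v ^ 2 / 4)) ^ 2 := fun v => by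
    rw [← sqrt_maxwellian, Real.sq_sqrt (maxwellian_pos v).le]
  have hinv : ∀ v, Maxwellian v ^ (-(1 : ℝ) / 2) = c⁻¹ * Real.exp (v ^ 2 / 4) := fun v => by
    have hE : Real.exp (v ^ 2 / 4) = (Real.exp (-v ^ 2 / 4))⁻¹ :=
      eq_inv_of_mul_eq_one_left (exp_sq_mul_exp_neg_sq v)
    rw [neg_div, Real.rpow_neg (maxwellian_pos v).le, ← Real.sqrt_eq_rpow, sqrt_maxwellian,
      mul_inv, ← hc, hE]
  have hinner : ∀ v, deriv (fun y => f y * Maxwellian y ^ (-(1 : ℝ) / 2)) v =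
      c⁻¹ * Real.exp (v ^ 2 / 4) * (f' v + v / 2 * f v) := fun v => by
    simp only [hinv]
    refine ((hd v).mul ((hasDerivAt_exp_sq_div_four v).const_mul c⁻¹)).deriv.trans ?_
    ring
  have hflux : (fun w => Maxwellian w * deriv (fun y => f y * Maxwellian y ^ (-(1 : ℝ) / 2)) w) =
      fun w => c * (Real.exp (-w ^ 2 / 4) * (f' w + w / 2 * f w)) := by
    funext w
    rw [hinner, hM]
    have hE := exp_sq_mul_exp_neg_sq w
    generalize Real.exp (w ^ 2 / 4) = a at hE ⊢
    generalize Real.exp (-w ^ 2 / 4) = b at hE ⊢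
    field_simp
    linear_combination b * (f' w * 2 + w * f w) * hE
  have hout := ((hasDerivAt_exp_neg_sq_div_four v).mul
    ((hd' v).add (((hasDerivAt_id v).div_const 2).mul (hd v)))).const_mul c
  have hder := hout.deriv
  rw [FPL, hflux, hinv]
  refine (congrArg _ hder).trans ?_
  simp only [id, Pi.add_apply, Pi.mul_apply]
  have hE := exp_sq_mul_exp_neg_sq v
  generalize Real.exp (v ^ 2 / 4) = a at hE ⊢
  generalize Real.exp (-v ^ 2 / 4) = b at hE ⊢
  have hcc : c⁻¹ * c = 1 := inv_mul_cancel₀ hcpos.ne'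
  linear_combination (f'' v + (1 / 2 - v ^ 2 / 4) * f v) * (hE + a * b * hcc)

theorem integral_maxwellian : ∫ v, Maxwellian v = 1 := by
  simp only [Maxwellian]
  rw [integral_const_mul]
  have h : ∫ v : ℝ, Real.exp (-v ^ 2 / 2) = √(2 * π) := by
    have := integral_gaussian (1 / 2)
    rw [show π / (1 / 2) = 2 * π by ring] at this
    rw [← this]
    congr 1; funext v; ring_nf
  rw [h, neg_div, Real.rpow_neg (by positivity), ← Real.sqrt_eq_rpow]
  exact inv_mul_cancel₀ (by positivity)

theorem integral_id_mul_maxwellian : ∫ v, v * Maxwellian v = 0 := by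
  have h := integral_neg_eq_self (fun v => v * Maxwellian v) volume
  have hodd : ∀ v, -v * Maxwellian (-v) = -(v * Maxwellian v) := fun v => by simp [Maxwellian]
  simp only [hodd, integral_neg] at h
  linarith

theorem prop_3_1_c (h : SchwartzMap ℝ ℝ) (σ u : ℝ)
    (hσ : σ = ∫ v : ℝ, h v * Real.sqrt (Maxwellian v))
    (hu : u = ∫ v : ℝ, h v * (v * Real.sqrt (Maxwellian v)))
    (g : ℝ → ℝ)
    (hg : g = fun v => h v - σ * Real.sqrt (Maxwellian v) - u * (v * Real.sqrt (Maxwellian v))) :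
    -(∫ v : ℝ, g v * FPL g v) ≥ ∫ v : ℝ, (g v)^2 := by
  set c : ℝ := √((2 * π) ^ (-(1 : ℝ) / 2)) with hc
  have hcpos : 0 < c := by positivity
  set m : ℝ → ℝ := fun v => √(Maxwellian v)
  have hmE : m = fun v => c * Real.exp (-v ^ 2 / 4) := funext sqrt_maxwellian
  have hmR : RapidDecay m := hmE ▸ rapidDecay_exp_neg_sq_div_four.const_mul c
  have hmd : ∀ v, HasDerivAt m (-(1 / 2) * (v * m v)) v := fun v => by
    rw [hmE]
    exact ((hasDerivAt_exp_neg_sq_div_four v).const_mul c).congr_deriv (by ring)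
  have hvmd : ∀ v, HasDerivAt (fun v => v * m v) (m v - 1 / 2 * (v * (v * m v))) v := fun v =>
    ((hasDerivAt_id v).mul (hmd v)).congr_deriv (by simp; ring)
  have hvvmd : ∀ v, HasDerivAt (fun v => v * (v * m v))
      (2 * (v * m v) - 1 / 2 * (v * (v * (v * m v)))) v := fun v =>
    ((hasDerivAt_id v).mul (hvmd v)).congr_deriv (by simp; ring)
  set h₁ := SchwartzMap.derivCLM ℝ ℝ h
  set h₂ := SchwartzMap.derivCLM ℝ ℝ h₁
  have hgR : RapidDecay g := hg ▸
    (h.rapidDecay.sub (hmR.const_mul σ)).sub (hmR.id_mul.const_mul u)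
  have hgR' := (h₁.rapidDecay.sub ((hmR.id_mul.const_mul (-(1 / 2))).const_mul σ)).sub
    ((hmR.sub (hmR.id_mul.id_mul.const_mul (1 / 2))).const_mul u)
  have hgR'' := (h₂.rapidDecay.sub
    (((hmR.sub (hmR.id_mul.id_mul.const_mul (1 / 2))).const_mul (-(1 / 2))).const_mul σ)).sub
    (((hmR.id_mul.const_mul (-(1 / 2))).sub (((hmR.id_mul.const_mul 2).sub
      (hmR.id_mul.id_mul.id_mul.const_mul (1 / 2))).const_mul (1 / 2))).const_mul u)
  have hd := fun v => ((h.hasDerivAt v).sub ((hmd v).const_mul σ)).sub ((hvmd v).const_mul u)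
  have hd' := fun v => ((h₁.hasDerivAt v).sub (((hvmd v).const_mul (-(1 / 2))).const_mul σ)).sub
    (((hmd v).sub ((hvvmd v).const_mul (1 / 2))).const_mul u)
  have hdg : ∀ v, HasDerivAt g _ v := fun v => by rw [hg]; exact hd v
  have hmm : ∀ v, m v * m v = Maxwellian v := fun v => Real.mul_self_sqrt (maxwellian_pos v).le
  have horth : ∫ v, g v * m v = 0 := by
    have i1 := (h.rapidDecay.mul hmR).integrable
    have i2 := ((hmR.mul hmR).const_mul σ).integrable
    have i3 := ((hmR.id_mul.mul hmR).const_mul u).integrable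
    have hexp : (fun v => g v * m v) =
        fun v => h v * m v - σ * (m v * m v) - u * (v * m v * m v) := by
      funext v; rw [hg]; ring
    rw [hexp, integral_sub (by exact i1.sub i2) i3, integral_sub i1 i2, integral_const_mul,
      integral_const_mul]
    simp only [mul_assoc, hmm, integral_maxwellian, integral_id_mul_maxwellian]
    rw [hσ]; ring
  have h0 : ∫ v, g v * Real.exp (-v ^ 2 / 4) = 0 := by
    have hscale : (fun v => g v * m v) = fun v => c * (g v * Real.exp (-v ^ 2 / 4)) := by
      funext v; rw [hmE]; ring
    rw [hscale, integral_const_mul] at horth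
    exact (mul_eq_zero.1 horth).resolve_left hcpos.ne'
  have hmain := integral_sq_le_of_integral_eq_zero hgR hgR' hgR'' hdg hd' h0
  simp only [FPL_eq hdg hd']
  exact hmain
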